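/- Let R = ℂ[[t]], F = ℂ((t)), K = F(x). For c ∈ F×, consider E_c: (X₁² − xY₁²)(X₂² − (x+1)Y₂²)(X₃² − x(x+1)Y₃²) = c. Then E_c(K) = ∅ if and only if c is not a square in F, which holds if and only if the t-adic valuation of c is odd. -/

import Mathlib

open Polynomial in
lemma aux_nonsq (f : ℂ[X]) (r : ℂ) (hf : f ≠ 0) (hodd : Odd (f.rootMultiplicity r)) :
    ¬ IsSquare (algebraMap ℂ[X] (RatFunc ℂ) f) := by
  rintro ⟨a, ha⟩
  induction a using RatFunc.induction_on with
  | f p q hq =>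
    have hq' : algebraMap ℂ[X] (RatFunc ℂ) q ≠ 0 := RatFunc.algebraMap_ne_zero hq
    have h1 : f * (q * q) = p * p := by
      apply RatFunc.algebraMap_injective ℂ
      rw [map_mul, ha, map_mul, map_mul]
      field_simp
    have hqq : q * q ≠ 0 := mul_ne_zero hq hq
    have hl : f * (q * q) ≠ 0 := mul_ne_zero hf hqq
    have h2 := congrArg (Polynomial.rootMultiplicity r) h1
    rw [Polynomial.rootMultiplicity_mul hl, Polynomial.rootMultiplicity_mul hqq,
      Polynomial.rootMultiplicity_mul (h1 ▸ hl)] at h2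
    obtain ⟨k, hk⟩ := hodd
    omega

open Polynomial in
lemma aux_rm1 (r : ℂ) (g : ℂ[X]) (hg : g.eval r ≠ 0) :
    ((X - C r) * g ≠ 0) ∧ Odd (((X - C r) * g).rootMultiplicity r) := by
  have hg0 : g ≠ 0 := by rintro rfl; simp at hg
  have h := mul_ne_zero (X_sub_C_ne_zero r) hg0
  refine ⟨h, ?_⟩
  rw [rootMultiplicity_mul h, rootMultiplicity_X_sub_C_self,
    rootMultiplicity_eq_zero (by simpa [IsRoot] using hg)]
  simp

lemma aux_sq1 : ¬ IsSquare (RatFunc.X : RatFunc ℂ) := by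
  obtain ⟨h1, h2⟩ := aux_rm1 0 1 (by simp)
  simpa using aux_nonsq _ 0 h1 h2

lemma aux_sq2 : ¬ IsSquare (RatFunc.X + 1 : RatFunc ℂ) := by
  obtain ⟨h1, h2⟩ := aux_rm1 (-1) 1 (by simp)
  simpa using aux_nonsq _ (-1) h1 h2

lemma aux_sq3 : ¬ IsSquare (RatFunc.X * (RatFunc.X + 1) : RatFunc ℂ) := by
  obtain ⟨h1, h2⟩ := aux_rm1 0 (Polynomial.X + 1) (by simp)
  simpa using aux_nonsq _ 0 h1 h2

/-- Norm forms of an unramified quadratic extension have even order. -/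
lemma aux_even {k : Type*} [Field k] (a : k) (ha : ¬ IsSquare a) (x y : LaurentSeries k)
    (h : x ^ 2 - HahnSeries.C a * y ^ 2 ≠ 0) :
    Even (x ^ 2 - HahnSeries.C a * y ^ 2 : LaurentSeries k).order := by
  have ha0 : a ≠ 0 := by rintro rfl; exact ha (IsSquare.zero)
  have hCa : (HahnSeries.C a : LaurentSeries k) ≠ 0 := by simpa using ha0
  by_cases hx : x = 0
  · subst hx
    have hy : y ≠ 0 := by rintro rfl; simp at h
    rw [zero_pow two_ne_zero, zero_sub, HahnSeries.order_neg,
      HahnSeries.order_mul hCa (pow_ne_zero 2 hy), HahnSeries.order_C, HahnSeries.order_pow]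
    simp
  by_cases hy : y = 0
  · subst hy
    simp
  have ox : (x ^ 2).order = 2 * x.order := by simp
  have oy : (HahnSeries.C a * y ^ 2).order = 2 * y.order := by
    rw [HahnSeries.order_mul hCa (pow_ne_zero 2 hy), HahnSeries.order_C, HahnSeries.order_pow]
    simp
  have cx : (x ^ 2).coeff (2 * x.order) = x.coeff x.order ^ 2 := by
    rw [pow_two, two_mul, HahnSeries.coeff_mul_order_add_order, HahnSeries.leadingCoeff_eq, pow_two]
  have cy : (HahnSeries.C a * y ^ 2).coeff (2 * y.order) = a * y.coeff y.order ^ 2 := by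
    rw [HahnSeries.C_mul_eq_smul, HahnSeries.coeff_smul,
      pow_two, two_mul, HahnSeries.coeff_mul_order_add_order, HahnSeries.leadingCoeff_eq, pow_two,
      smul_eq_mul]
  have nx : x.coeff x.order ≠ 0 := by simpa [HahnSeries.coeff_order_eq_zero] using hx
  have ny : y.coeff y.order ≠ 0 := by simpa [HahnSeries.coeff_order_eq_zero] using hy
  have key : (x ^ 2 - HahnSeries.C a * y ^ 2 : LaurentSeries k).order
      = 2 * min x.order y.order := by
    apply le_antisymm
    · apply HahnSeries.order_le_of_coeff_ne_zero
      rw [HahnSeries.coeff_sub]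
      rcases lt_trichotomy x.order y.order with hlt | heq | hlt
      · rw [min_eq_left hlt.le, cx,
          HahnSeries.coeff_eq_zero_of_lt_order (x := HahnSeries.C a * y ^ 2) (by rw [oy]; omega)]
        simpa using nx
      · rw [heq, min_self, cy, ← heq, cx, heq]
        intro h0
        apply ha
        refine ⟨x.coeff x.order / y.coeff y.order, ?_⟩
        rw [← heq] at h0 ⊢
        rw [← heq] at ny
        field_simp
        linear_combination -h0
      · rw [min_eq_right hlt.le, cy,
          HahnSeries.coeff_eq_zero_of_lt_order (x := x ^ 2) (by rw [ox]; omega)]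
        simp [ha0, ny]
    · rw [HahnSeries.le_order_iff_forall h]
      intro j hj
      rw [HahnSeries.coeff_sub,
        HahnSeries.coeff_eq_zero_of_lt_order (x := HahnSeries.C a * y ^ 2) (by rw [oy]; omega),
        HahnSeries.coeff_eq_zero_of_lt_order (x := x ^ 2) (by rw [ox]; omega), sub_zero]
  rw [key]
  exact even_two_mul _

/-- Coefficientwise inclusion `ℂ((t)) → ℂ(x)((t))`. -/
noncomputable def auxPhi : LaurentSeries ℂ →+* LaurentSeries (RatFunc ℂ) where
  toFun x := x.map (RatFunc.C : ℂ →+* RatFunc ℂ)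
  map_zero' := by ext; simp
  map_one' := by
    ext n
    by_cases hn : n = 0 <;> simp [HahnSeries.coeff_one, hn]
  map_add' x y := by ext; simp
  map_mul' x y := HahnSeries.map_mul (RatFunc.C : ℂ →+* RatFunc ℂ).toNonUnitalRingHom

lemma auxPhi_coeff (x : LaurentSeries ℂ) (n : ℤ) :
    (auxPhi x).coeff n = RatFunc.C (x.coeff n) := rfl

lemma auxPhi_order (x : LaurentSeries ℂ) (hx : x ≠ 0) : (auxPhi x).order = x.order := by
  have h0 : auxPhi x ≠ 0 := (map_ne_zero _).2 hx
  apply le_antisymm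
  · apply HahnSeries.order_le_of_coeff_ne_zero
    rw [auxPhi_coeff]
    simpa [HahnSeries.coeff_order_eq_zero] using hx
  · rw [HahnSeries.le_order_iff_forall h0]
    intro j hj
    rw [auxPhi_coeff, HahnSeries.coeff_eq_zero_of_lt_order hj, map_zero]

/-- Evaluation of polynomials over `ℂ((t))` at `x ∈ ℂ(x)((t))`. -/
noncomputable def auxPsi : Polynomial (LaurentSeries ℂ) →+* LaurentSeries (RatFunc ℂ) :=
  Polynomial.eval₂RingHom auxPhi (HahnSeries.C RatFunc.X)

lemma auxPsi_inj : Function.Injective auxPsi := by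
  rw [injective_iff_map_eq_zero]
  intro p hp
  ext i n
  have h1 := congrArg (fun s => HahnSeries.coeff s n) hp
  let q : Polynomial ℂ := ∑ j ∈ p.support, Polynomial.monomial j ((p.coeff j).coeff n)
  have h2 : algebraMap (Polynomial ℂ) (RatFunc ℂ) q = 0 := by
    rw [← HahnSeries.coeff_zero (a := n), ← hp]
    simp only [auxPsi, Polynomial.coe_eval₂RingHom, Polynomial.eval₂_eq_sum, Polynomial.sum, q]
    rw [HahnSeries.coeff_sum, map_sum]
    refine Finset.sum_congr rfl fun j _ => ?_
    rw [← map_pow, mul_comm, HahnSeries.C_mul_eq_smul, HahnSeries.coeff_smul, auxPhi_coeff,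
      ← Polynomial.C_mul_X_pow_eq_monomial]
    rw [map_mul, map_pow, RatFunc.algebraMap_C, RatFunc.algebraMap_X, smul_eq_mul, mul_comm]
  have h3 : q = 0 := by
    apply RatFunc.algebraMap_injective ℂ
    rw [h2, map_zero]
  have h4 := congrArg (fun s => Polynomial.coeff s i) h3
  simp only [q, Polynomial.finsetSum_coeff, Polynomial.coeff_monomial] at h4
  by_cases hi : i ∈ p.support
  · simpa [hi] using h4
  · simp [Polynomial.notMem_support_iff.1 hi]

lemma auxPsi_unit (y : nonZeroDivisors (Polynomial (LaurentSeries ℂ))) :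
    IsUnit (auxPsi (y : Polynomial (LaurentSeries ℂ))) := by
  have h : auxPsi (y : Polynomial (LaurentSeries ℂ)) ≠ 0 := by
    rw [Ne, map_eq_zero_iff _ auxPsi_inj]
    exact nonZeroDivisors.coe_ne_zero y
  exact IsUnit.mk0 (G₀ := LaurentSeries (RatFunc ℂ)) _ h

/-- The embedding `ℂ((t))(x) → ℂ(x)((t))`. -/
noncomputable def auxTheta : RatFunc (LaurentSeries ℂ) →+* LaurentSeries (RatFunc ℂ) :=
  IsLocalization.lift (R := Polynomial (LaurentSeries ℂ))
    (M := nonZeroDivisors (Polynomial (LaurentSeries ℂ)))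
    (S := RatFunc (LaurentSeries ℂ)) (P := LaurentSeries (RatFunc ℂ))
    (g := auxPsi) auxPsi_unit

lemma auxTheta_X : auxTheta RatFunc.X = HahnSeries.C RatFunc.X := by
  have h := IsLocalization.lift_eq (R := Polynomial (LaurentSeries ℂ))
    (M := nonZeroDivisors (Polynomial (LaurentSeries ℂ)))
    (S := RatFunc (LaurentSeries ℂ)) (P := LaurentSeries (RatFunc ℂ))
    (g := auxPsi) auxPsi_unit Polynomial.X
  rw [RatFunc.algebraMap_X] at h
  refine Eq.trans h ?_
  simp [auxPsi]

lemma auxTheta_C (c : LaurentSeries ℂ) : auxTheta (RatFunc.C c) = auxPhi c := by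
  have h := IsLocalization.lift_eq (S := RatFunc (LaurentSeries ℂ)) auxPsi_unit (Polynomial.C c)
  rw [RatFunc.algebraMap_C] at h
  refine Eq.trans h ?_
  simp [auxPsi]

lemma aux_point_even (c : LaurentSeries ℂ) (hc : c ≠ 0)
    (h : ∃ X1 Y1 X2 Y2 X3 Y3 : RatFunc (LaurentSeries ℂ),
        (X1 ^ 2 - RatFunc.X * Y1 ^ 2)
          * (X2 ^ 2 - (RatFunc.X + 1) * Y2 ^ 2)
          * (X3 ^ 2 - (RatFunc.X * (RatFunc.X + 1)) * Y3 ^ 2)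
        = RatFunc.C c) : Even c.order := by
  obtain ⟨X1, Y1, X2, Y2, X3, Y3, h⟩ := h
  have h := congrArg auxTheta h
  simp only [map_mul, map_sub, map_add, map_pow, map_one, auxTheta_X, auxTheta_C] at h
  have e2 : (HahnSeries.C RatFunc.X + 1 : LaurentSeries (RatFunc ℂ))
      = HahnSeries.C (RatFunc.X + 1) := by simp
  rw [e2, ← map_mul] at h
  have h0 : auxPhi c ≠ 0 := (map_ne_zero _).2 hc
  rw [← h] at h0
  have n3 := right_ne_zero_of_mul h0
  have n12 := left_ne_zero_of_mul h0
  have n2 := right_ne_zero_of_mul n12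
  have n1 := left_ne_zero_of_mul n12
  rw [← auxPhi_order c hc, ← h, HahnSeries.order_mul n12 n3, HahnSeries.order_mul n1 n2]
  exact ((aux_even _ aux_sq1 _ _ n1).add (aux_even _ aux_sq2 _ _ n2)).add
    (aux_even _ aux_sq3 _ _ n3)

/-- A complex power series with nonzero constant term is a square. -/
lemma aux_ps_sq (f : PowerSeries ℂ) (hf : PowerSeries.constantCoeff f ≠ 0) : IsSquare f := by
  obtain ⟨a, ha⟩ := IsAlgClosed.exists_pow_nat_eq (PowerSeries.constantCoeff f) two_pos
  have ha0 : a ≠ 0 := by rintro rfl; apply hf; rw [← ha]; simp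
  let u : PowerSeries ℂ := PowerSeries.C (PowerSeries.constantCoeff f)⁻¹ * f - 1
  have hu : PowerSeries.HasSubst u := by
    apply PowerSeries.HasSubst.of_constantCoeff_zero'
    simp [u, hf]
  have hb : PowerSeries.binomialSeries ℂ (1 / 2 : ℚ) * PowerSeries.binomialSeries ℂ (1 / 2 : ℚ)
      = 1 + PowerSeries.X := by
    rw [← PowerSeries.binomialSeries_add]
    have := PowerSeries.binomialSeries_nat (R := ℚ) (A := ℂ) 1
    norm_num at this ⊢
    exact this
  have hs := congrArg (PowerSeries.substAlgHom (R := ℂ) hu) hb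
  rw [map_mul, map_add, map_one, PowerSeries.substAlgHom_X] at hs
  refine ⟨PowerSeries.C a * PowerSeries.substAlgHom (R := ℂ) hu
    (PowerSeries.binomialSeries ℂ (1 / 2 : ℚ)), ?_⟩
  rw [mul_mul_mul_comm, hs, ← map_mul, ← pow_two, ha]
  have : (1 : PowerSeries ℂ) + u = PowerSeries.C (PowerSeries.constantCoeff f)⁻¹ * f := by
    simp [u]
  rw [this, ← mul_assoc, ← map_mul, mul_inv_cancel₀ hf, map_one, one_mul]

lemma aux_sq_iff (c : LaurentSeries ℂ) (hc : c ≠ 0) : IsSquare c ↔ Even c.order := by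
  constructor
  · rintro ⟨a, rfl⟩
    have ha : a ≠ 0 := left_ne_zero_of_mul hc
    exact ⟨a.order, HahnSeries.order_mul ha ha⟩
  · rintro ⟨m, hm⟩
    rw [← c.single_order_mul_powerSeriesPart]
    apply IsSquare.mul
    · exact ⟨HahnSeries.single m 1, by simp [hm]⟩
    · apply IsSquare.map (HahnSeries.ofPowerSeries ℤ ℂ)
      apply aux_ps_sq
      rw [← PowerSeries.coeff_zero_eq_constantCoeff_apply, LaurentSeries.powerSeriesPart_coeff]
      simpa [HahnSeries.coeff_order_eq_zero] using hc


/-- Let `R = ℂ[[t]]`, `F = ℂ((t))`, `K = F(x)`. For `c ∈ Fˣ`, consider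
`E_c : (X₁² − xY₁²)(X₂² − (x+1)Y₂²)(X₃² − x(x+1)Y₃²) = c`. Then `E_c(K) = ∅` if and only
if `c` is not a square in `F`, which holds if and only if the `t`-adic valuation of `c` is
odd (the valuation of a nonzero Laurent series being its `order`). -/
theorem stmt_16 (c : LaurentSeries ℂ) (hc : c ≠ 0) :
    ((¬ ∃ X1 Y1 X2 Y2 X3 Y3 : RatFunc (LaurentSeries ℂ),
        (X1 ^ 2 - RatFunc.X * Y1 ^ 2)
          * (X2 ^ 2 - (RatFunc.X + 1) * Y2 ^ 2)
          * (X3 ^ 2 - (RatFunc.X * (RatFunc.X + 1)) * Y3 ^ 2)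
        = RatFunc.C c)
      ↔ ¬ IsSquare c)
    ∧ (¬ IsSquare c ↔ Odd c.order) := by
  refine ⟨not_congr ⟨fun h => (aux_sq_iff c hc).2 (aux_point_even c hc h), ?_⟩, ?_⟩
  · rintro ⟨d, rfl⟩
    exact ⟨RatFunc.C d, 0, 1, 0, 1, 0, by simp [pow_two]⟩
  · rw [aux_sq_iff c hc, Int.not_even_iff_odd]
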